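/- Let X, Y be finite sets, ρ = η₁ ⊗ η₂ a product probability distribution on X × Y, q₁ : X → [0,1], q₂ : Y → [0,1] with τ := Σ_{x,y} q₁(x)q₂(y)ρ(x,y) > 0, and define σ(x,y) = q₁(x)q₂(y)ρ(x,y)/τ. Let E ⊆ X × Y with σ(E) ≤ ε. Then there exist A ⊆ X and B ⊆ Y such that σ(A × B) ≥ 9/16 and ρ(E ∩ (A × B)) ≤ 16ε · ρ(A × B). -/

import Mathlib

open scoped Classical

open Finset

/-- Markov-type selection step. -/
lemma markov_select {X : Type*} [Fintype X] (w f : X → ℝ) (c : ℝ) (hc : 0 ≤ c)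
    (hw : ∀ x, 0 ≤ w x) (hf : ∀ x, 0 ≤ f x)
    (h : ∑ x, w x * f x ≤ c * ∑ x, w x) :
    3 / 4 * ∑ x, w x ≤ ∑ x ∈ univ.filter (fun x => f x ≤ 4 * c), w x := by
  have hsplit := sum_filter_add_sum_filter_not univ (fun x => f x ≤ 4 * c) w
  have hW : 0 ≤ ∑ x, w x := sum_nonneg fun x _ => hw x
  rcases hc.eq_or_lt with hc0 | hc0
  · subst hc0
    have h0 : ∑ x, w x * f x = 0 :=
      le_antisymm (by simpa using h) (sum_nonneg fun x _ => mul_nonneg (hw x) (hf x))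
    rw [sum_eq_zero_iff_of_nonneg (fun x _ => mul_nonneg (hw x) (hf x))] at h0
    have h1 : ∑ x ∈ univ.filter (fun x => ¬ f x ≤ 4 * 0), w x = 0 := by
      apply sum_eq_zero
      intro x hx
      have hx2 := (mem_filter.mp hx).2
      rcases mul_eq_zero.mp (h0 x (mem_univ x)) with h2 | h2
      · exact h2
      · exact absurd (by rw [h2]; norm_num) hx2
    rw [h1, add_zero] at hsplit
    rw [hsplit]
    linarith
  · have h1 : (∑ x ∈ univ.filter (fun x => ¬ f x ≤ 4 * c), w x) * (4 * c) ≤ ∑ x, w x * f x := by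
      rw [sum_mul]
      refine (sum_le_sum fun x hx => ?_).trans
        (sum_le_sum_of_subset_of_nonneg (filter_subset _ _)
          fun x _ _ => mul_nonneg (hw x) (hf x))
      exact mul_le_mul_of_nonneg_left (not_le.mp (mem_filter.mp hx).2).le (hw x)
    have h2 : (∑ x ∈ univ.filter (fun x => ¬ f x ≤ 4 * c), w x) * 4 ≤ ∑ x, w x := by
      apply le_of_mul_le_mul_left _ hc0
      linarith
    linarith

/-- Main rectangle lemma (Lemma `app-main`): for a product distribution `ρ` and the
posterior `σ(x,y) = q₁(x)q₂(y)ρ(x,y)/τ` of a fixed transcript, if the error set `E`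
has `σ`-mass at most `ε`, then there is a rectangle `A × B` with `σ(A×B) ≥ 9/16`
on which the `ρ`-conditional error is at most `16ε`. -/
theorem rectangle_lemma {X Y : Type*} [Fintype X] [Fintype Y]
    (η1 : X → ℝ) (η2 : Y → ℝ) (ρ : X × Y → ℝ) (q1 : X → ℝ) (q2 : Y → ℝ)
    (E : Finset (X × Y)) (ε : ℝ) (hε : 0 ≤ ε)
    (hη1 : ∀ x, 0 ≤ η1 x) (hη2 : ∀ y, 0 ≤ η2 y)
    (hη1sum : ∑ x, η1 x = 1) (hη2sum : ∑ y, η2 y = 1)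
    (hrect : ∀ x y, ρ (x, y) = η1 x * η2 y)
    (hq1 : ∀ x, q1 x ∈ Set.Icc (0 : ℝ) 1) (hq2 : ∀ y, q2 y ∈ Set.Icc (0 : ℝ) 1)
    (hτpos : 0 < ∑ x, ∑ y, q1 x * q2 y * ρ (x, y))
    (hEσ : (∑ p ∈ E, q1 p.1 * q2 p.2 * ρ p) / (∑ x, ∑ y, q1 x * q2 y * ρ (x, y)) ≤ ε) :
    ∃ (A : Finset X) (B : Finset Y),
      (∑ x ∈ A, ∑ y ∈ B, q1 x * q2 y * ρ (x, y)) /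
          (∑ x, ∑ y, q1 x * q2 y * ρ (x, y)) ≥ 9 / 16 ∧
      ∑ p ∈ E.filter (fun p => p.1 ∈ A ∧ p.2 ∈ B), ρ p ≤
        16 * ε * ∑ x ∈ A, ∑ y ∈ B, ρ (x, y) := by
  have hprod : ∀ (A : Finset X) (B : Finset Y), ∑ x ∈ A, ∑ y ∈ B, q1 x * q2 y * ρ (x, y) =
      (∑ x ∈ A, q1 x * η1 x) * ∑ y ∈ B, q2 y * η2 y := by
    intro A B
    rw [sum_mul_sum]
    refine sum_congr rfl fun x _ => sum_congr rfl fun y _ => ?_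
    rw [hrect]; ring
  have hprod2 : ∀ (A : Finset X) (B : Finset Y), ∑ x ∈ A, ∑ y ∈ B, ρ (x, y) =
      (∑ x ∈ A, η1 x) * ∑ y ∈ B, η2 y := by
    intro A B
    rw [sum_mul_sum]
    exact sum_congr rfl fun x _ => sum_congr rfl fun y _ => hrect x y
  have hw1 : ∀ x, 0 ≤ q1 x * η1 x := fun x => mul_nonneg (hq1 x).1 (hη1 x)
  have hw2 : ∀ y, 0 ≤ q2 y * η2 y := fun y => mul_nonneg (hq2 y).1 (hη2 y)
  rw [div_le_iff₀ hτpos] at hEσ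
  have hW1 : 0 ≤ ∑ x, q1 x * η1 x := sum_nonneg fun x _ => hw1 x
  have hW2 : 0 ≤ ∑ y, q2 y * η2 y := sum_nonneg fun y _ => hw2 y
  have hE1 : ∑ p ∈ E, q1 p.1 * q2 p.2 * ρ p =
      ∑ x, q1 x * η1 x * ∑ y, if (x, y) ∈ E then q2 y * η2 y else 0 := by
    have : ∑ p ∈ E, q1 p.1 * q2 p.2 * ρ p =
        ∑ p : X × Y, if p ∈ E then q1 p.1 * q2 p.2 * ρ p else 0 := by
      rw [← sum_filter]; congr 1; ext; simp
    rw [this, Fintype.sum_prod_type]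
    refine sum_congr rfl fun x _ => ?_
    rw [mul_sum]
    refine sum_congr rfl fun y _ => ?_
    rw [hrect]
    split_ifs <;> ring
  rw [hprod] at hEσ
  have hA := markov_select (fun x => q1 x * η1 x)
    (fun x => ∑ y, if (x, y) ∈ E then q2 y * η2 y else 0)
    (ε * ∑ y, q2 y * η2 y) (mul_nonneg hε hW2) hw1
    (fun x => sum_nonneg fun y _ => by split_ifs <;> simp [hw2]) (by
      rw [← hE1]; linarith)
  have hmem : ∀ x ∈ univ.filter (fun x => (∑ y, if (x, y) ∈ E then q2 y * η2 y else 0) ≤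
      4 * (ε * ∑ y, q2 y * η2 y)), (∑ y, if (x, y) ∈ E then q2 y * η2 y else 0) ≤
      4 * (ε * ∑ y, q2 y * η2 y) := fun x hx => (mem_filter.mp hx).2
  generalize univ.filter (fun x => (∑ y, if (x, y) ∈ E then q2 y * η2 y else 0) ≤
      4 * (ε * ∑ y, q2 y * η2 y)) = A at hA hmem
  have hηA : 0 ≤ ∑ x ∈ A, η1 x := sum_nonneg fun x _ => hη1 x
  have hB := markov_select (fun y => q2 y * η2 y)
    (fun y => ∑ x ∈ A, if (x, y) ∈ E then η1 x else 0)
    (4 * ε * ∑ x ∈ A, η1 x) (mul_nonneg (by linarith) hηA) hw2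
    (fun y => sum_nonneg fun x _ => by split_ifs <;> simp [hη1]) (by
      have : ∑ y, q2 y * η2 y * ∑ x ∈ A, (if (x, y) ∈ E then η1 x else 0) =
          ∑ x ∈ A, η1 x * ∑ y, if (x, y) ∈ E then q2 y * η2 y else 0 := by
        simp_rw [mul_sum]
        rw [sum_comm]
        refine sum_congr rfl fun x _ => sum_congr rfl fun y _ => ?_
        split_ifs <;> ring
      rw [this]
      calc _ ≤ ∑ x ∈ A, η1 x * (4 * (ε * ∑ y, q2 y * η2 y)) :=
            sum_le_sum fun x hx => mul_le_mul_of_nonneg_left (hmem x hx) (hη1 x)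
        _ = _ := by rw [← sum_mul]; ring)
  have hmemB : ∀ y ∈ univ.filter (fun y => (∑ x ∈ A, if (x, y) ∈ E then η1 x else 0) ≤
      4 * (4 * ε * ∑ x ∈ A, η1 x)), (∑ x ∈ A, if (x, y) ∈ E then η1 x else 0) ≤
      4 * (4 * ε * ∑ x ∈ A, η1 x) := fun y hy => (mem_filter.mp hy).2
  generalize univ.filter (fun y => (∑ x ∈ A, if (x, y) ∈ E then η1 x else 0) ≤
      4 * (4 * ε * ∑ x ∈ A, η1 x)) = B at hB hmemB
  refine ⟨A, B, ?_, ?_⟩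
  · rw [ge_iff_le, le_div_iff₀ hτpos, hprod, hprod]
    have := mul_le_mul hA hB (by linarith) (by linarith)
    linarith
  · rw [hprod2]
    have h1 : ∑ p ∈ E.filter (fun p => p.1 ∈ A ∧ p.2 ∈ B), ρ p =
        ∑ y ∈ B, η2 y * ∑ x ∈ A, if (x, y) ∈ E then η1 x else 0 := by
      have h2 : E.filter (fun p => p.1 ∈ A ∧ p.2 ∈ B) = (A ×ˢ B).filter (fun p => p ∈ E) := by
        ext p; simp only [mem_filter, mem_product]; tauto
      rw [h2, sum_filter, sum_product_right]
      refine sum_congr rfl fun y _ => ?_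
      rw [mul_sum]
      refine sum_congr rfl fun x _ => ?_
      rw [hrect]
      split_ifs <;> ring
    rw [h1]
    calc _ ≤ ∑ y ∈ B, η2 y * (4 * (4 * ε * ∑ x ∈ A, η1 x)) :=
          sum_le_sum fun y hy => mul_le_mul_of_nonneg_left (hmemB y hy) (hη2 y)
      _ = _ := by rw [← sum_mul]; ring
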